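/- Let f : ℂ → ℂ be holomorphic on the punctured open unit disk D \ {0} and suppose that the area integral ∫_{D\{0}} |f| dA is finite. Then f has at worst a simple pole at the origin: there exists a function g, holomorphic on all of D, such that f(z) = g(z)/z for every z ∈ D \ {0}. -/

import Mathlib

open MeasureTheory Metric

open Filter Topology Set
open scoped ENNReal

theorem Complex.lintegral_comp_mul_left_of_norm_eq_one {a : ℂ} (ha : ‖a‖ = 1) (F : ℂ → ℝ≥0∞) :
    ∫⁻ w, F (a * w) = ∫⁻ w, F w := by
  let c : Circle := ⟨a, mem_sphere_zero_iff_norm.2 ha⟩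
  exact (rotation c).measurePreserving.lintegral_comp_emb
    (rotation c).toHomeomorph.measurableEmbedding F

section MeanValue

variable {E : Type*} [NormedAddCommGroup E] [NormedSpace ℂ E] [CompleteSpace E]

/-- The mean value inequality for the norm over circles, with an arbitrary starting point `z + w`
on the circle. -/
theorem DifferentiableOn.enorm_mul_two_pi_le_lintegral_circleMap {f : ℂ → E} {z w : ℂ} {r : ℝ}
    (hf : DifferentiableOn ℂ f (ball z r)) (hw : w ∈ ball (0 : ℂ) r) :
    ‖f z‖ₑ * ENNReal.ofReal (2 * Real.pi) ≤
      ∫⁻ θ in Ioc 0 (2 * Real.pi), ‖f (z + circleMap 0 1 θ * w)‖ₑ := by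
  have hmaps : MapsTo (fun ζ : ℂ => z + ζ * w) (closedBall 0 1) (ball z r) := by
    intro ζ hζ
    rw [mem_closedBall_zero_iff] at hζ
    rw [mem_ball_zero_iff] at hw
    simpa [mem_ball_iff_norm] using
      (mul_le_of_le_one_left (norm_nonneg w) hζ).trans_lt hw
  have hg : DifferentiableOn ℂ (fun ζ : ℂ => f (z + ζ * w)) (closedBall 0 1) :=
    hf.comp (by fun_prop) hmaps
  have hd : DiffContOnCl ℂ (fun ζ : ℂ => f (z + ζ * w)) (ball 0 |1|) := by
    apply DifferentiableOn.diffContOnCl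
    rw [abs_one, closure_ball _ one_ne_zero]
    exact hg
  have havg := hd.circleAverage
  have hpi : 0 < 2 * Real.pi := Real.two_pi_pos
  rw [Real.circleAverage_def, inv_smul_eq_iff₀ hpi.ne',
    intervalIntegral.integral_of_le hpi.le] at havg
  calc ‖f z‖ₑ * ENNReal.ofReal (2 * Real.pi)
      = ‖(2 * Real.pi) • f (z + 0 * w)‖ₑ := by
        rw [enorm_smul, Real.enorm_eq_ofReal hpi.le, mul_comm, zero_mul, add_zero]
    _ = _ := by rw [← havg]
    _ ≤ _ := enorm_integral_le_lintegral_enorm _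

/-- The mean value inequality for the norm over disks. -/
theorem DifferentiableOn.enorm_mul_volume_ball_le {f : ℂ → E} {z : ℂ} {r : ℝ}
    (hf : DifferentiableOn ℂ f (ball z r)) :
    ‖f z‖ₑ * volume (ball z r) ≤ ∫⁻ w in ball z r, ‖f w‖ₑ := by
  set F : ℂ → ℝ≥0∞ := (ball z r).indicator fun w => ‖f w‖ₑ with hF
  have hFm : Measurable F := by
    classical
    rw [hF, ← piecewise_eq_indicator]
    exact hf.continuousOn.enorm.measurable_piecewise continuousOn_const measurableSet_ball
  have hpi : 0 < 2 * Real.pi := Real.two_pi_pos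
  have hcircle : ∀ w ∈ ball (0 : ℂ) r, ‖f z‖ₑ * ENNReal.ofReal (2 * Real.pi) ≤
      ∫⁻ θ in Ioc 0 (2 * Real.pi), F (z + circleMap 0 1 θ * w) := by
    intro w hw
    refine (hf.enorm_mul_two_pi_le_lintegral_circleMap hw).trans_eq (lintegral_congr fun θ => ?_)
    rw [hF, indicator_of_mem]
    simpa [mem_ball_iff_norm] using hw
  have hvol : volume (ball z r) = volume (ball (0 : ℂ) r) := by
    simp only [Complex.volume_ball]
  have key : ‖f z‖ₑ * ENNReal.ofReal (2 * Real.pi) * volume (ball z r) ≤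
      (∫⁻ w, F w) * ENNReal.ofReal (2 * Real.pi) := by
    calc ‖f z‖ₑ * ENNReal.ofReal (2 * Real.pi) * volume (ball z r)
        = ∫⁻ _ in ball (0 : ℂ) r, ‖f z‖ₑ * ENNReal.ofReal (2 * Real.pi) := by
          rw [setLIntegral_const, hvol]
      _ ≤ ∫⁻ w in ball (0 : ℂ) r, ∫⁻ θ in Ioc 0 (2 * Real.pi), F (z + circleMap 0 1 θ * w) :=
          setLIntegral_mono' measurableSet_ball hcircle
      _ ≤ ∫⁻ w, ∫⁻ θ in Ioc 0 (2 * Real.pi), F (z + circleMap 0 1 θ * w) :=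
          setLIntegral_le_lintegral _ _
      _ = ∫⁻ θ in Ioc 0 (2 * Real.pi), ∫⁻ w, F (z + circleMap 0 1 θ * w) := by
          refine lintegral_lintegral_swap (Measurable.aemeasurable (hFm.comp ?_))
          have := (continuous_circleMap 0 1).measurable
          fun_prop
      _ = ∫⁻ _ in Ioc 0 (2 * Real.pi), ∫⁻ w, F w := by
          refine lintegral_congr fun θ => ?_
          rw [Complex.lintegral_comp_mul_left_of_norm_eq_one (by simp) fun w => F (z + w),
            lintegral_add_left_eq_self]
      _ = (∫⁻ w, F w) * ENNReal.ofReal (2 * Real.pi) := by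
          rw [setLIntegral_const, Real.volume_Ioc, sub_zero]
  rw [mul_right_comm, hF, lintegral_indicator measurableSet_ball] at key
  exact (ENNReal.mul_le_mul_iff_left (by simpa using hpi) ENNReal.ofReal_ne_top).1 key

end MeanValue

theorem Complex.tendsto_volume_ball_half_norm :
    Tendsto (fun z : ℂ => volume (ball z (‖z‖ / 2))) (𝓝 0) (𝓝 0) := by
  simp only [Complex.volume_ball]
  have h : Tendsto (fun z : ℂ => ENNReal.ofReal (‖z‖ / 2) ^ 2 * NNReal.pi) (𝓝 0)
      (𝓝 (ENNReal.ofReal (‖(0 : ℂ)‖ / 2) ^ 2 * NNReal.pi)) := by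
    refine Continuous.tendsto ?_ 0
    refine (ENNReal.continuous_mul_const ENNReal.coe_ne_top).comp ?_
    exact (ENNReal.continuous_pow 2).comp (ENNReal.continuous_ofReal.comp (by fun_prop))
  simpa using h

/-- An integrable holomorphic function on a punctured neighborhood of the origin
is `o(‖z‖⁻²)` there. -/
theorem tendsto_sq_mul_of_integrable_holomorphic {f : ℂ → ℂ}
    (hf : DifferentiableOn ℂ f (ball (0 : ℂ) 1 \ {0}))
    (hint : IntegrableOn (fun z => ‖f z‖) (ball (0 : ℂ) 1 \ {0}) volume) :
    Tendsto (fun z => z ^ 2 * f z) (𝓝[≠] 0) (𝓝 0) := by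
  have hU : MeasurableSet (ball (0 : ℂ) 1 \ {0}) :=
    measurableSet_ball.diff (measurableSet_singleton 0)
  have hfin : ∫⁻ w, (ball (0 : ℂ) 1 \ {0}).indicator (fun w => ‖f w‖ₑ) w ≠ ∞ := by
    rw [lintegral_indicator hU]
    simpa [HasFiniteIntegral] using hint.2.ne
  have hlim := tendsto_setLIntegral_zero hfin
    (Complex.tendsto_volume_ball_half_norm.mono_left (nhdsWithin_le_nhds (s := {0}ᶜ)))
  have hlim' := ENNReal.Tendsto.const_mul (a := 4) hlim (Or.inr (by simp))
  rw [mul_zero] at hlim'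
  rw [tendsto_zero_iff_enorm_tendsto_zero]
  refine tendsto_of_tendsto_of_tendsto_of_le_of_le' tendsto_const_nhds hlim'
    (Eventually.of_forall fun _ => zero_le) ?_
  have hsmall : ∀ᶠ z : ℂ in 𝓝[≠] 0, z ∈ ball (0 : ℂ) (1 / 2) :=
    nhdsWithin_le_nhds (ball_mem_nhds _ (by norm_num))
  filter_upwards [hsmall, self_mem_nhdsWithin] with z hz hz0
  have hz0' : 0 < ‖z‖ := norm_pos_iff.2 hz0
  rw [mem_ball_zero_iff] at hz
  have hsub : ball z (‖z‖ / 2) ⊆ ball (0 : ℂ) 1 \ {0} := by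
    intro w hw
    rw [mem_ball_iff_norm] at hw
    refine ⟨?_, ?_⟩
    · rw [mem_ball_zero_iff]
      linarith [norm_le_norm_add_norm_sub z w, norm_sub_rev z w]
    · rintro rfl
      rw [zero_sub, norm_neg] at hw
      linarith
  have hmean := (hf.mono hsub).enorm_mul_volume_ball_le
  have hone : (1 : ℝ≥0∞) ≤ NNReal.pi := by
    exact_mod_cast (show (1 : ℝ) ≤ Real.pi by linarith [Real.pi_gt_three])
  have hsq : ‖z‖ₑ ^ 2 ≤ 4 * volume (ball z (‖z‖ / 2)) := by
    rw [Complex.volume_ball]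
    calc ‖z‖ₑ ^ 2 = 4 * ENNReal.ofReal (‖z‖ / 2) ^ 2 := by
          rw [← ofReal_norm, ← ENNReal.ofReal_pow hz0'.le,
            ← ENNReal.ofReal_pow (by positivity), ← ENNReal.ofReal_ofNat,
            ← ENNReal.ofReal_mul (by norm_num)]
          congr 1
          ring
      _ ≤ 4 * (ENNReal.ofReal (‖z‖ / 2) ^ 2 * NNReal.pi) := by
          gcongr
          exact le_mul_of_one_le_right' hone
  calc ‖z ^ 2 * f z‖ₑ = ‖z‖ₑ ^ 2 * ‖f z‖ₑ := by rw [enorm_mul, enorm_pow]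
    _ ≤ 4 * volume (ball z (‖z‖ / 2)) * ‖f z‖ₑ := by gcongr
    _ = 4 * (‖f z‖ₑ * volume (ball z (‖z‖ / 2))) := by ring
    _ ≤ 4 * ∫⁻ w in ball z (‖z‖ / 2), ‖f w‖ₑ := by gcongr
    _ = _ := by
      congr 1
      exact setLIntegral_congr_fun measurableSet_ball fun w hw =>
        (indicator_of_mem (hsub hw) fun w => ‖f w‖ₑ).symm

/-- A function holomorphic on the punctured open unit disk whose absolute value has
finite area integral there has at worst a simple pole at the origin: it is of the
form `g z / z` for a function `g` holomorphic on the whole disk. -/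
theorem simple_pole_of_integrable_holomorphic (f : ℂ → ℂ)
    (hf : DifferentiableOn ℂ f (ball (0 : ℂ) 1 \ {0}))
    (hint : IntegrableOn (fun z => ‖f z‖) (ball (0 : ℂ) 1 \ {0}) volume) :
    ∃ g : ℂ → ℂ, DifferentiableOn ℂ g (ball (0 : ℂ) 1) ∧
      ∀ z ∈ ball (0 : ℂ) 1 \ {0}, f z = g z / z := by
  have ho : (fun z => z * f z - 0 * f 0) =o[𝓝[≠] 0] fun z : ℂ => (z - 0)⁻¹ := by
    rw [Asymptotics.isLittleO_iff_tendsto']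
    · refine (tendsto_sq_mul_of_integrable_holomorphic hf hint).congr fun z => ?_
      rw [zero_mul, sub_zero, sub_zero, div_inv_eq_mul]
      ring
    · filter_upwards [self_mem_nhdsWithin] with z hz h
      exact absurd (by simpa using h) hz
  refine ⟨_, Complex.differentiableOn_update_limUnder_of_isLittleO
    (ball_mem_nhds 0 one_pos) (differentiableOn_id.mul hf) ho, fun z hz => ?_⟩
  have hz0 : z ≠ 0 := hz.2
  rw [Function.update_of_ne hz0]
  exact (mul_div_cancel_left₀ _ hz0).symm
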